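/- arXiv:1703.00165 — 4 statements merged into one kernel-verified Lean document; each statement's English description precedes it below -/
import Mathlib

section
/- Let A be a countable discrete subset of ℝ, let c : A → ℂ be such that ∑_{ν ∈ A} |c(ν)| < ∞, and set S(u) = ∑_{ν ∈ A} c(ν) e^{2πiνu} for u ∈ ℝ. Then for every θ ∈ (0,1) and every U > 0, ∫_{-U}^{U} |S(u)|² du ≤ (πθ / sin(πθ))² · ∫_{-∞}^{+∞} | (U/θ) · ∑_{ν ∈ A, t ≤ ν ≤ t + θ/U} c(ν) |² dt. -/
open MeasureTheory Real Complex
open scoped Classical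

open scoped FourierTransform ContDiff SchwartzMap

theorem MeasureTheory.Integrable.continuous_fourier_real {f : ℝ → ℂ} (hf : Integrable f) :
    Continuous (𝓕 f) :=
  VectorFourier.fourierIntegral_continuous Real.continuous_fourierChar
    (L := innerₗ ℝ) continuous_inner hf

/-- On `L¹ ∩ L²` the `L²` Fourier transform is given by the Fourier integral. -/
theorem MeasureTheory.MemLp.fourier_toLp_ae_eq {f : ℝ → ℂ} (hf : Integrable f)
    (hf2 : MemLp f 2) :
    (𝓕 (hf2.toLp f) : Lp ℂ 2 (volume : Measure ℝ)) =ᵐ[volume] 𝓕 f := by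
  refine ae_eq_of_integral_contDiff_smul_eq
    ((Lp.memLp (𝓕 (hf2.toLp f) : Lp ℂ 2 (volume : Measure ℝ))).locallyIntegrable one_le_two)
    hf.continuous_fourier_real.locallyIntegrable fun g hg hgc => ?_
  have hc : HasCompactSupport (Complex.ofRealCLM ∘ g) := hgc.comp_left rfl
  have hd : ContDiff ℝ ∞ (Complex.ofRealCLM ∘ g) := by fun_prop
  set G : 𝓢(ℝ, ℂ) := hc.toSchwartzMap hd
  have hG : ∀ x, G x = (g x : ℂ) := fun x => rfl
  have h1 : ∫ x, G x • (𝓕 (hf2.toLp f) : Lp ℂ 2 (volume : Measure ℝ)) x = ∫ x, (𝓕 G) x • f x := by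
    rw [← Lp.toTemperedDistribution_apply, ← Lp.fourier_toTemperedDistribution_eq,
      TemperedDistribution.fourier_apply, Lp.toTemperedDistribution_apply]
    refine integral_congr_ae ?_
    filter_upwards [hf2.coeFn_toLp] with x hx
    rw [hx]
  have h2 : ∫ x, (𝓕 G) x • f x = ∫ x, G x • 𝓕 f x := by
    simpa [SchwartzMap.fourier_coe] using!
      VectorFourier.integral_fourierIntegral_smul_eq_flip (L := innerₗ ℝ)
        Real.continuous_fourierChar continuous_inner G.integrable hf
  simpa [hG] using h1.trans h2

theorem MeasureTheory.L2.norm_sq_eq_integral_norm_sq (f : Lp ℂ 2 (volume : Measure ℝ)) :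
    ‖f‖ ^ 2 = ∫ x, ‖f x‖ ^ 2 := by
  have h := L2.inner_def (𝕜 := ℂ) f f
  simp only [inner_self_eq_norm_sq_to_K] at h
  have h' : ∫ x, ((‖f x‖ : ℂ)) ^ 2 = ((∫ x, ‖f x‖ ^ 2 : ℝ) : ℂ) := by
    rw [← integral_complex_ofReal]
    simp
  apply Complex.ofReal_injective
  rw [← h']
  simpa using h

/-- **Plancherel's theorem** for the Fourier integral of a function in `L¹ ∩ L²`. -/
theorem MeasureTheory.MemLp.integral_norm_fourier_sq {f : ℝ → ℂ} (hf : Integrable f)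
    (hf2 : MemLp f 2) : ∫ u, ‖𝓕 f u‖ ^ 2 = ∫ t, ‖f t‖ ^ 2 := by
  have h := congrArg (· ^ 2) (Lp.norm_fourier_eq (hf2.toLp f))
  simp only [L2.norm_sq_eq_integral_norm_sq] at h
  rw [integral_congr_ae (g := fun u => ‖𝓕 f u‖ ^ 2),
    integral_congr_ae (f := fun t => ‖hf2.toLp f t‖ ^ 2) (g := fun t => ‖f t‖ ^ 2)] at h
  · exact h
  · filter_upwards [hf2.coeFn_toLp] with x hx
    rw [hx]
  · filter_upwards [hf2.fourier_toLp_ae_eq hf] with x hx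
    rw [hx]

theorem MeasureTheory.MemLp.integrable_norm_fourier_sq {f : ℝ → ℂ} (hf : Integrable f)
    (hf2 : MemLp f 2) : Integrable fun u => ‖𝓕 f u‖ ^ 2 :=
  ((memLp_congr_ae (hf2.fourier_toLp_ae_eq hf)).1 (Lp.memLp _)).integrable_norm_pow two_ne_zero

/-- A series of integrable functions with summable `L¹` norms has an integrable sum. -/
theorem MeasureTheory.integrable_tsum_of_summable_integral_norm {α ι E : Type*}
    [MeasurableSpace α] {μ : Measure α} [NormedAddCommGroup E] [CompleteSpace E] [Countable ι]
    {f : ι → α → E} (hf : ∀ i, Integrable (f i) μ) (hs : Summable fun i => ∫ a, ‖f i a‖ ∂μ) :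
    Integrable (fun a => ∑' i, f i a) μ := by
  have hnorm (i : ι) : ‖(hf i).toL1 (f i)‖ = ∫ a, ‖f i a‖ ∂μ := by
    rw [L1.norm_of_fun_eq_integral_norm]
  have hne : ∑' i, ‖(hf i).toL1 (f i)‖ₑ ≠ ⊤ :=
    tsum_enorm_ne_top_iff_summable_norm.2 (by simpa only [hnorm] using hs)
  refine (L1.integrable_coeFn (∑' i, (hf i).toL1 (f i))).congr ?_
  filter_upwards [Lp.coeFn_tsum hne, ae_all_iff.2 fun i => (hf i).coeFn_toL1] with a ha hb
  rw [ha]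
  exact tsum_congr hb

section WindowSum

variable {ι : Type*}

/-- The sum of the coefficients `c i` over the frequencies `x i` in the window `[t, t + δ]`. -/
noncomputable def windowSum (x : ι → ℝ) (c : ι → ℂ) (δ t : ℝ) : ℂ :=
  ∑' i, if t ≤ x i ∧ x i ≤ t + δ then c i else 0

theorem window_ite_eq_indicator (x δ t : ℝ) (c : ℂ) :
    (if t ≤ x ∧ x ≤ t + δ then c else 0) = (Set.Icc (x - δ) x).indicator (fun _ => c) t := by
  simp only [Set.indicator_apply, Set.mem_Icc, sub_le_iff_le_add, and_comm]

theorem windowSum_eq_tsum_indicator (x : ι → ℝ) (c : ι → ℂ) (δ t : ℝ) :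
    windowSum x c δ t = ∑' i, (Set.Icc (x i - δ) (x i)).indicator (fun _ => c i) t := by
  simp only [windowSum, window_ite_eq_indicator]

theorem integrable_indicator_Icc_const (a b : ℝ) (c : ℂ) :
    Integrable ((Set.Icc a b).indicator fun _ => c) :=
  (integrable_indicator_iff measurableSet_Icc).2 (integrableOn_const (by simp))

theorem integral_norm_indicator_Icc_sub (x : ℝ) {δ : ℝ} (hδ : 0 ≤ δ) (c : ℂ) :
    ∫ t, ‖(Set.Icc (x - δ) x).indicator (fun _ => c) t‖ = δ * ‖c‖ := by
  simp_rw [norm_indicator_eq_indicator_norm]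
  rw [integral_indicator measurableSet_Icc]
  simp [Measure.real, hδ]

theorem norm_windowSum_le (x : ι → ℝ) {c : ι → ℂ} (hc : Summable fun i => ‖c i‖) (δ t : ℝ) :
    ‖windowSum x c δ t‖ ≤ ∑' i, ‖c i‖ :=
  tsum_of_norm_bounded hc.hasSum fun i => by split_ifs <;> simp

theorem integrable_windowSum [Countable ι] (x : ι → ℝ) {c : ι → ℂ}
    (hc : Summable fun i => ‖c i‖) {δ : ℝ} (hδ : 0 ≤ δ) : Integrable (windowSum x c δ) := by
  simp only [funext (windowSum_eq_tsum_indicator x c δ)]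
  refine integrable_tsum_of_summable_integral_norm
    (fun i => integrable_indicator_Icc_const _ _ _) ?_
  simpa only [integral_norm_indicator_Icc_sub _ hδ] using hc.mul_left δ

theorem memLp_two_windowSum [Countable ι] (x : ι → ℝ) {c : ι → ℂ}
    (hc : Summable fun i => ‖c i‖) {δ : ℝ} (hδ : 0 ≤ δ) : MemLp (windowSum x c δ) 2 := by
  have hi := integrable_windowSum x hc hδ
  rw [memLp_two_iff_integrable_sq_norm hi.aestronglyMeasurable]
  refine (hi.norm.const_mul (∑' i, ‖c i‖)).mono'
    (hi.aestronglyMeasurable.norm.pow 2) (.of_forall fun t => ?_)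
  rw [Real.norm_of_nonneg (by positivity), sq]
  gcongr
  exact norm_windowSum_le x hc δ t

theorem fourier_indicator_Icc_sub (x : ℝ) {δ : ℝ} (hδ : 0 ≤ δ) (c : ℂ) {u : ℝ} (hu : u ≠ 0) :
    𝓕 ((Set.Icc (x - δ) x).indicator fun _ => c) u =
      c * Complex.exp (-(2 * π * I * x * u)) *
        ((Complex.exp (I * (2 * π * δ * u : ℝ)) - 1) / (2 * π * I * u)) := by
  have hk : -(2 * π * I * u) ≠ 0 := by
    simp [hu, Real.pi_ne_zero]
  have h (v : ℝ) : Complex.exp ((-2 * π * v * u : ℝ) * I) •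
      (Set.Icc (x - δ) x).indicator (fun _ => c) v =
      (Set.Icc (x - δ) x).indicator (fun v : ℝ => Complex.exp (-(2 * π * I * u) * v) * c) v := by
    by_cases hv : v ∈ Set.Icc (x - δ) x
    · simp only [Set.indicator_of_mem hv, smul_eq_mul]
      push_cast
      ring_nf
    · simp [Set.indicator_of_notMem hv]
  rw [fourier_real_eq_integral_exp_smul]
  simp_rw [h]
  rw [integral_indicator measurableSet_Icc, integral_Icc_eq_integral_Ioc,
    ← intervalIntegral.integral_of_le (by linarith), intervalIntegral.integral_mul_const,
    integral_exp_mul_complex hk]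
  have he : Complex.exp (-(2 * π * I * u) * (x - δ : ℝ)) =
      Complex.exp (-(2 * π * I * x * u)) * Complex.exp (I * (2 * π * δ * u : ℝ)) := by
    rw [← Complex.exp_add]
    push_cast
    ring_nf
  rw [he, show -(2 * π * I * u) * (x : ℂ) = -(2 * π * I * x * u) by ring, div_neg]
  ring

theorem fourier_windowSum [Countable ι] (x : ι → ℝ) {c : ι → ℂ}
    (hc : Summable fun i => ‖c i‖) {δ : ℝ} (hδ : 0 ≤ δ) {u : ℝ} (hu : u ≠ 0) :
    𝓕 (windowSum x c δ) u =
      (∑' i, c i * Complex.exp (-(2 * π * I * x i * u))) *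
        ((Complex.exp (I * (2 * π * δ * u : ℝ)) - 1) / (2 * π * I * u)) := by
  rw [← tsum_mul_right]
  simp_rw [← fourier_indicator_Icc_sub _ hδ _ hu, fourier_real_eq]
  rw [integral_tsum_of_summable_integral_norm]
  · simp_rw [windowSum_eq_tsum_indicator, Circle.smul_def, smul_eq_mul, tsum_mul_left]
  · intro i
    simpa [mul_comm] using
      (Real.fourierIntegral_convergent_iff (V := ℝ) u).2
        (integrable_indicator_Icc_const (x i - δ) (x i) (c i))
  · simp_rw [Circle.norm_smul, integral_norm_indicator_Icc_sub _ hδ]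
    exact hc.mul_left δ

theorem norm_fourier_windowSum [Countable ι] (x : ι → ℝ) {c : ι → ℂ}
    (hc : Summable fun i => ‖c i‖) {δ : ℝ} (hδ : 0 ≤ δ) {u : ℝ} (hu : u ≠ 0) :
    ‖𝓕 (windowSum x c δ) u‖ =
      ‖∑' i, c i * Complex.exp (-(2 * π * I * x i * u))‖ *
        (|Real.sin (π * δ * u)| / (π * |u|)) := by
  rw [fourier_windowSum x hc hδ hu, norm_mul, norm_div, Complex.norm_exp_I_mul_ofReal_sub_one]
  congr 1
  simp only [norm_mul, Real.norm_eq_abs, Complex.norm_real, Complex.norm_I, Complex.norm_ofNat,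
    abs_of_pos Real.pi_pos, Nat.abs_ofNat, mul_assoc, one_mul]
  rw [show 2 * (π * (δ * u)) / 2 = π * (δ * u) by ring, mul_div_mul_left _ _ two_ne_zero]

end WindowSum

theorem Real.mul_sin_le_sin_mul {s y : ℝ} (hs0 : 0 ≤ s) (hs1 : s ≤ 1) (hy0 : 0 ≤ y)
    (hy : y ≤ π) : s * Real.sin y ≤ Real.sin (s * y) := by
  have h := strictConcaveOn_sin_Icc.concaveOn.2 (x := 0) (y := y) ⟨le_rfl, Real.pi_pos.le⟩
    ⟨hy0, hy⟩ (sub_nonneg.2 hs1) hs0 (sub_add_cancel 1 s)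
  simpa using h

theorem sin_div_le_abs_sin_div {θ U u : ℝ} (hθ0 : 0 ≤ θ) (hθ1 : θ ≤ 1) (hU : 0 < U)
    (hu : u ≠ 0) (huU : |u| ≤ U) :
    Real.sin (π * θ) / (π * U) ≤ |Real.sin (π * (θ / U) * u)| / (π * |u|) := by
  have hu' := abs_pos.2 hu
  have h := Real.mul_sin_le_sin_mul (s := |u| / U) (y := π * θ) (by positivity)
    ((div_le_one hU).2 huU) (by positivity) (by nlinarith [Real.pi_pos])
  have h2 : |Real.sin (π * (θ / U) * u)| = |Real.sin (|u| / U * (π * θ))| := by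
    rw [show |u| / U * (π * θ) = π * (θ / U) * |u| by ring]
    rcases abs_choice u with hc | hc <;> rw [hc]
    rw [mul_neg, Real.sin_neg, abs_neg]
  rw [h2, div_le_div_iff₀ (by positivity) (by positivity)]
  have h3 := h.trans (le_abs_self _)
  rw [div_mul_eq_mul_div, div_le_iff₀ hU] at h3
  nlinarith [Real.pi_pos]

/-- **Gallagher's lemma.** If `A ⊆ ℝ` is countable and discrete, `c : A → ℂ` is
absolutely summable and `S u = ∑_{ν ∈ A} c ν · e^{2πiνu}`, then for `θ ∈ (0,1)`
and `U > 0`,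
`∫_{-U}^{U} |S u|² du ≤ (πθ/sin(πθ))² ∫_ℝ |(U/θ) ∑_{ν ∈ A, t ≤ ν ≤ t+θ/U} c ν|² dt`. -/
theorem gallagher_lemma (A : Set ℝ) (hA : A.Countable) (hdisc : DiscreteTopology A)
    (c : A → ℂ) (hc : Summable fun ν : A => ‖c ν‖)
    (S : ℝ → ℂ)
    (hS : ∀ u : ℝ, S u = ∑' ν : A, c ν * Complex.exp (2 * Real.pi * Complex.I * (ν : ℝ) * u))
    (θ U : ℝ) (hθ : θ ∈ Set.Ioo (0 : ℝ) 1) (hU : 0 < U) :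
    (∫ u in (-U)..U, ‖S u‖ ^ 2) ≤
      (Real.pi * θ / Real.sin (Real.pi * θ)) ^ 2 *
        ∫ t : ℝ, ‖((U / θ : ℝ) : ℂ) *
          ∑' ν : A, (if t ≤ (ν : ℝ) ∧ (ν : ℝ) ≤ t + θ / U then c ν else 0)‖ ^ 2 := by
  have : Countable A := hA.to_subtype
  obtain ⟨hθ0, hθ1⟩ := hθ
  have hδ : 0 ≤ θ / U := by positivity
  set F := windowSum (fun ν : A => (ν : ℝ)) c (θ / U) with hF
  have hi : Integrable F := integrable_windowSum _ hc hδ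
  have h2 : MemLp F 2 := memLp_two_windowSum _ hc hδ
  have hsin : 0 < Real.sin (π * θ) :=
    Real.sin_pos_of_pos_of_lt_pi (by positivity) (by nlinarith [Real.pi_pos])
  set K := Real.sin (π * θ) / (π * U) with hK
  have hKpos : 0 < K := by positivity
  have hpt {u : ℝ} (hu : u ≠ 0) (huU : |u| ≤ U) :
      K ^ 2 * ‖S (-u)‖ ^ 2 ≤ ‖𝓕 F u‖ ^ 2 := by
    rw [hF, norm_fourier_windowSum _ hc hδ hu, hS, ← mul_pow, mul_comm K]
    push_cast
    simp_rw [mul_neg]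
    gcongr
    exact sin_div_le_abs_sin_div hθ0.le hθ1.le hU hu huU
  have hScont : Continuous S := by
    rw [funext hS]
    refine continuous_tsum (fun ν => by fun_prop) hc fun ν u => ?_
    rw [norm_mul, show 2 * (π : ℂ) * I * (ν : ℝ) * u = (2 * π * ν * u : ℝ) * I by
      push_cast; ring, Complex.norm_exp_ofReal_mul_I, mul_one]
  have hle : K ^ 2 * ∫ u in (-U)..U, ‖S u‖ ^ 2 ≤ ∫ t, ‖F t‖ ^ 2 := by
    have hrefl : ∫ u in (-U)..U, ‖S u‖ ^ 2 = ∫ u in (-U)..U, ‖S (-u)‖ ^ 2 := by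
      simp [intervalIntegral.integral_comp_neg (fun u => ‖S u‖ ^ 2)]
    rw [hrefl, ← h2.integral_norm_fourier_sq hi, ← intervalIntegral.integral_const_mul]
    have hint := h2.integrable_norm_fourier_sq hi
    have hle0 : -U ≤ U := by linarith
    calc ∫ u in (-U)..U, K ^ 2 * ‖S (-u)‖ ^ 2
        ≤ ∫ u in (-U)..U, ‖𝓕 F u‖ ^ 2 := by
          refine intervalIntegral.integral_mono_ae_restrict hle0
            (Continuous.intervalIntegrable (by fun_prop) _ _) hint.intervalIntegrable ?_
          filter_upwards [ae_restrict_mem measurableSet_Icc,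
            ae_restrict_of_ae (Measure.ae_ne volume (0 : ℝ))] with u hu hu0
          exact hpt hu0 (abs_le.2 hu)
      _ ≤ ∫ u, ‖𝓕 F u‖ ^ 2 := by
          rw [intervalIntegral.integral_of_le hle0]
          exact setIntegral_le_integral hint (.of_forall fun u => by positivity)
  change _ ≤ _ * ∫ t, ‖((U / θ : ℝ) : ℂ) * F t‖ ^ 2
  simp_rw [norm_mul, mul_pow, Complex.norm_real, Real.norm_eq_abs, sq_abs]
  rw [integral_const_mul, ← mul_assoc, ← mul_pow,
    show π * θ / Real.sin (π * θ) * (U / θ) = K⁻¹ by rw [hK]; field_simp, inv_pow]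
  rwa [le_inv_mul_iff₀ (by positivity)]
end

section
/- There exists an absolute constant K > 0 with the following property. Let F be a finite set of real numbers, write ρ(γ) = 1/2 + iγ, let T ≥ 1 with |γ| ≤ T for all γ ∈ F, and suppose there is C > 0 such that for every t ∈ ℝ, ∑_{γ ∈ F, t < |ρ(γ)| ≤ t+1} 1/|ρ(γ)| ≤ C. Then for every natural number n, ∫_{e^n}^{e^{n+1}} | ∑_{γ ∈ F} x^{1/2 + iγ} / (1/2 + iγ) |² dx ≤ K · C² · e^{2n} · (T + 2). -/
open MeasureTheory Real Complex
open scoped Classical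

/-- The map `γ ↦ ‖1/2 + iγ‖` is 1-Lipschitz. -/
theorem abs_norm_half_add_I_mul_sub_le (x y : ℝ) :
    |‖(1 / 2 + I * (x : ℂ))‖ - ‖(1 / 2 + I * (y : ℂ))‖| ≤ |x - y| := by
  refine (abs_norm_sub_norm_le _ _).trans_eq ?_
  rw [show (1 / 2 + I * (x : ℂ)) - (1 / 2 + I * (y : ℂ)) =
    I * ((x - y : ℝ) : ℂ) by push_cast; ring]
  rw [norm_mul, norm_I, one_mul, norm_real, Real.norm_eq_abs]

/-- A bound for weighted sums over unit blocks of a 1-Lipschitz image passes to unit blocks of the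
variable itself, up to a factor `2`. -/
theorem sum_unit_block_le {F : Finset ℝ} {C : ℝ} (hC : 0 ≤ C) {g w : ℝ → ℝ}
    (hg : ∀ x y, |g x - g y| ≤ |x - y|)
    (h : ∀ t : ℝ, (∑ γ ∈ F, if t < g γ ∧ g γ ≤ t + 1 then w γ else 0) ≤ C)
    (hw : ∀ x, 0 ≤ w x) (s : ℝ) :
    ∑ γ ∈ F with s ≤ γ ∧ γ < s + 1, w γ ≤ 2 * C := by
  rcases (F.filter fun γ => s ≤ γ ∧ γ < s + 1).eq_empty_or_nonempty with h0 | ⟨c, hc⟩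
  · rw [h0]; simpa using hC
  · simp only [Finset.mem_filter] at hc
    have h1 := h (g c - 1)
    have h2 := h (g c)
    have : ∑ γ ∈ F with s ≤ γ ∧ γ < s + 1, w γ ≤
        ∑ γ ∈ F, ((if g c - 1 < g γ ∧ g γ ≤ g c - 1 + 1 then w γ else 0) +
          (if g c < g γ ∧ g γ ≤ g c + 1 then w γ else 0)) := by
      rw [Finset.sum_filter]
      refine Finset.sum_le_sum fun γ hγ => ?_
      have hwγ := hw γ
      by_cases hs : s ≤ γ ∧ γ < s + 1
      · have h3 : |g γ - g c| < 1 := (hg γ c).trans_lt (abs_lt.2 ⟨by linarith, by linarith⟩)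
        rw [abs_lt] at h3
        rcases le_or_gt (g γ) (g c) with h4 | h4
        · rw [if_pos hs, if_pos ⟨by linarith, by linarith⟩]
          split_ifs <;> linarith
        · rw [if_pos hs, if_pos (c := g c < g γ ∧ _) ⟨by linarith, by linarith⟩]
          split_ifs <;> linarith
      · rw [if_neg hs]
        split_ifs <;> linarith
    rw [Finset.sum_add_distrib] at this
    linarith

theorem summable_one_div_one_add_int_sq : Summable fun k : ℤ => 1 / (1 + (k : ℝ) ^ 2) := by
  have h := (Real.summable_one_div_int_pow (p := 2)).2 (by norm_num)
  refine Summable.of_norm_bounded_eventually h ?_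
  filter_upwards [(Set.finite_singleton (0:ℤ)).compl_mem_cofinite] with k hk
  have : (0:ℝ) < (k:ℝ)^2 := by
    have : k ≠ 0 := by simpa using hk
    positivity
  rw [Real.norm_of_nonneg (by positivity)]
  gcongr
  linarith

/-- Convolution of unit-block bounded weights with the kernel `1 / (1 + x ^ 2)` is bounded. -/
theorem sum_div_one_add_sq_le {F : Finset ℝ} {B : ℝ} {w : ℝ → ℝ}
    (h : ∀ s : ℝ, ∑ γ ∈ F with s ≤ γ ∧ γ < s + 1, w γ ≤ B)
    (hw : ∀ x, 0 ≤ w x) (hB : 0 ≤ B) (c : ℝ) :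
    ∑ γ ∈ F, w γ / (1 + (c - γ) ^ 2) ≤ 3 * B * ∑' k : ℤ, 1 / (1 + (k : ℝ) ^ 2) := by
  have hm : ∀ γ ∈ F, ⌊γ - c⌋ ∈ F.image fun γ => ⌊γ - c⌋ := fun γ hγ => Finset.mem_image_of_mem _ hγ
  rw [← Finset.sum_fiberwise_of_maps_to hm]
  have h1 : ∀ k : ℤ, ∑ γ ∈ F with ⌊γ - c⌋ = k, w γ / (1 + (c - γ) ^ 2) ≤
      3 * B * (1 / (1 + (k : ℝ) ^ 2)) := by
    intro k
    calc _ ≤ ∑ γ ∈ F with ⌊γ - c⌋ = k, w γ * (3 * (1 / (1 + (k : ℝ) ^ 2))) := by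
          refine Finset.sum_le_sum fun γ hγ => ?_
          rw [Finset.mem_filter, Int.floor_eq_iff] at hγ
          obtain ⟨-, h2, h3⟩ := hγ
          rw [div_eq_mul_inv]
          refine mul_le_mul_of_nonneg_left ?_ (hw γ)
          rw [mul_one_div, inv_eq_one_div, div_le_div_iff₀ (by positivity) (by positivity)]
          nlinarith [sq_nonneg (2 * (γ - c) - k)]
      _ = (∑ γ ∈ F with (c + k) ≤ γ ∧ γ < (c + k) + 1, w γ) * (3 * (1 / (1 + (k : ℝ) ^ 2))) := by
          rw [← Finset.sum_mul]
          congr 2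
          ext γ
          simp only [Finset.mem_filter, Int.floor_eq_iff]
          refine and_congr_right fun _ => and_congr ?_ ?_ <;> constructor <;> intro _ <;> linarith
      _ ≤ B * (3 * (1 / (1 + (k : ℝ) ^ 2))) := by gcongr; exact h _
      _ = _ := by ring
  calc _ ≤ ∑ k ∈ F.image fun γ => ⌊γ - c⌋, 3 * B * (1 / (1 + (k : ℝ) ^ 2)) :=
      Finset.sum_le_sum fun k _ => h1 k
    _ = 3 * B * ∑ k ∈ F.image fun γ => ⌊γ - c⌋, (1 / (1 + (k : ℝ) ^ 2)) := by rw [Finset.mul_sum]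
    _ ≤ _ := by
      gcongr
      exact summable_one_div_one_add_int_sq.sum_le_tsum _ fun k _ => by positivity

/-- Unit-block bounded weights supported in `[-T, T]` have total mass `O(T + 1)`. -/
theorem sum_le_of_unit_block_le {F : Finset ℝ} {B T : ℝ} {w : ℝ → ℝ}
    (h : ∀ s : ℝ, ∑ γ ∈ F with s ≤ γ ∧ γ < s + 1, w γ ≤ B)
    (hB : 0 ≤ B) (hT : 0 ≤ T) (hF : ∀ γ ∈ F, |γ| ≤ T) :
    ∑ γ ∈ F, w γ ≤ B * (2 * T + 2) := by
  have hm : ∀ γ ∈ F, ⌊γ⌋ ∈ Finset.Icc ⌊-T⌋ ⌊T⌋ := fun γ hγ => by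
    have := abs_le.1 (hF γ hγ)
    exact Finset.mem_Icc.2 ⟨Int.floor_le_floor this.1, Int.floor_le_floor this.2⟩
  rw [← Finset.sum_fiberwise_of_maps_to hm]
  have h1 : ∀ k ∈ Finset.Icc ⌊-T⌋ ⌊T⌋, ∑ γ ∈ F with ⌊γ⌋ = k, w γ ≤ B := by
    intro k _
    simpa only [Int.floor_eq_iff] using h k
  refine (Finset.sum_le_card_nsmul _ _ _ h1).trans ?_
  rw [nsmul_eq_mul, mul_comm]
  refine mul_le_mul_of_nonneg_left ?_ hB
  have h2 : ⌊-T⌋ ≤ ⌊T⌋ := Int.floor_le_floor (by linarith)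
  have h3 : ((Finset.Icc ⌊-T⌋ ⌊T⌋).card : ℤ) = ⌊T⌋ + 1 - ⌊-T⌋ := by
    rw [Int.card_Icc, Int.toNat_of_nonneg (by linarith)]
  have h4 : ((Finset.Icc ⌊-T⌋ ⌊T⌋).card : ℝ) = ⌊T⌋ + 1 - ⌊-T⌋ := by exact_mod_cast h3
  rw [h4]
  linarith [Int.floor_le T, Int.sub_one_lt_floor (-T)]

/-- The Fourier transform of `exp (-|u|)`. -/
theorem integral_exp_neg_abs_mul_cexp (x : ℝ) :
    Integrable (fun u : ℝ => (Real.exp (-|u|) : ℂ) * cexp (I * x * u)) ∧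
    ∫ u : ℝ, (Real.exp (-|u|) : ℂ) * cexp (I * x * u) = ((2 / (1 + x ^ 2) : ℝ) : ℂ) := by
  have ha : (-1 + I * x : ℂ).re < 0 := by simp
  have hb : 0 < (1 + I * x : ℂ).re := by simp
  have e1 : Set.EqOn (fun u : ℝ => cexp ((-1 + I * x) * u))
      (fun u : ℝ => (Real.exp (-|u|) : ℂ) * cexp (I * x * u)) (Set.Ioi 0) := by
    intro u hu
    simp only [abs_of_pos (Set.mem_Ioi.1 hu), ofReal_exp, ← Complex.exp_add]
    push_cast; ring_nf
  have e2 : Set.EqOn (fun u : ℝ => cexp ((1 + I * x) * u))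
      (fun u : ℝ => (Real.exp (-|u|) : ℂ) * cexp (I * x * u)) (Set.Iic 0) := by
    intro u hu
    simp only [abs_of_nonpos (Set.mem_Iic.1 hu), ofReal_exp, ← Complex.exp_add]
    push_cast; ring_nf
  have i1 := (integrableOn_exp_mul_complex_Ioi ha 0).congr_fun e1 measurableSet_Ioi
  have i2 := (integrableOn_exp_mul_complex_Iic hb 0).congr_fun e2 measurableSet_Iic
  refine ⟨by simpa [Set.Iic_union_Ioi] using i2.union i1, ?_⟩
  rw [← intervalIntegral.integral_Iic_add_Ioi i2 i1, ← setIntegral_congr_fun measurableSet_Ioi e1,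
    ← setIntegral_congr_fun measurableSet_Iic e2, integral_exp_mul_complex_Ioi ha,
    integral_exp_mul_complex_Iic hb]
  have n1 : (-1 + I * x : ℂ) ≠ 0 := fun h => by simp [h] at ha
  have n2 : (1 + I * x : ℂ) ≠ 0 := fun h => by simp [h] at hb
  have n3 : (1 + x ^ 2 : ℂ) ≠ 0 := by
    have : (1 + x ^ 2 : ℝ) ≠ 0 := by positivity
    exact_mod_cast this
  push_cast
  simp only [mul_zero, Complex.exp_zero]
  field_simp
  ring_nf
  simp
  ring

/-- Mean square of an exponential sum over `[0, 1]`, bounded through the majorant `exp (1 - |u|)`. -/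
theorem integral_norm_sq_exp_sum_le (F : Finset ℝ) (a : ℝ → ℂ) :
    ∫ u in (0:ℝ)..1, ‖∑ γ ∈ F, a γ * cexp (I * γ * u)‖ ^ 2 ≤
      Real.exp 1 * ∑ γ ∈ F, ∑ δ ∈ F, ‖a γ‖ * ‖a δ‖ * (2 / (1 + (γ - δ) ^ 2)) := by
  set S : ℝ → ℂ := fun u => ∑ γ ∈ F, a γ * cexp (I * γ * u) with hS
  have hSc : Continuous S := by fun_prop
  have hexp : ∀ u : ℝ, ((Real.exp (-|u|) * ‖S u‖ ^ 2 : ℝ) : ℂ) =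
      ∑ γ ∈ F, ∑ δ ∈ F, a γ * (starRingEnd ℂ) (a δ) *
        ((Real.exp (-|u|) : ℂ) * cexp (I * (γ - δ : ℝ) * u)) := by
    intro u
    rw [ofReal_mul, ofReal_pow, ← Complex.mul_conj', hS, map_sum, Finset.sum_mul_sum, Finset.mul_sum]
    refine Finset.sum_congr rfl fun γ _ => ?_
    rw [Finset.mul_sum]
    refine Finset.sum_congr rfl fun δ _ => ?_
    rw [map_mul, ← Complex.exp_conj, show I * (γ - δ : ℝ) * (u : ℂ) =
      I * γ * u + (starRingEnd ℂ) (I * δ * u) by simp; ring, Complex.exp_add]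
    ring
  have hint : ∀ γ δ : ℝ, Integrable fun u : ℝ => a γ * (starRingEnd ℂ) (a δ) *
        ((Real.exp (-|u|) : ℂ) * cexp (I * (γ - δ : ℝ) * u)) :=
    fun γ δ => (integral_exp_neg_abs_mul_cexp (γ - δ)).1.const_mul _
  have hI : Integrable fun u : ℝ => Real.exp (-|u|) * ‖S u‖ ^ 2 := by
    have : Integrable fun u : ℝ => ((Real.exp (-|u|) * ‖S u‖ ^ 2 : ℝ) : ℂ) := by
      simp_rw [hexp]
      exact integrable_finsetSum _ fun γ _ => integrable_finsetSum _ fun δ _ => hint γ δ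
    exact this.re
  have hval : ((∫ u : ℝ, Real.exp (-|u|) * ‖S u‖ ^ 2 : ℝ) : ℂ) =
      ∑ γ ∈ F, ∑ δ ∈ F, a γ * (starRingEnd ℂ) (a δ) * ((2 / (1 + (γ - δ) ^ 2) : ℝ) : ℂ) := by
    rw [← integral_complex_ofReal]
    simp_rw [hexp]
    rw [integral_finsetSum _ fun γ _ => integrable_finsetSum _ fun δ _ => hint γ δ]
    refine Finset.sum_congr rfl fun γ _ => ?_
    rw [integral_finsetSum _ fun δ _ => hint γ δ]
    refine Finset.sum_congr rfl fun δ _ => ?_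
    rw [integral_const_mul, (integral_exp_neg_abs_mul_cexp _).2]
  have hle : ∫ u : ℝ, Real.exp (-|u|) * ‖S u‖ ^ 2 ≤
      ∑ γ ∈ F, ∑ δ ∈ F, ‖a γ‖ * ‖a δ‖ * (2 / (1 + (γ - δ) ^ 2)) := by
    refine (le_abs_self _).trans ?_
    rw [← Real.norm_eq_abs, ← norm_real, hval]
    refine (norm_sum_le _ _).trans (Finset.sum_le_sum fun γ _ => (norm_sum_le _ _).trans
      (Finset.sum_le_sum fun δ _ => ?_))
    rw [norm_mul, norm_mul, RCLike.norm_conj, norm_real, Real.norm_of_nonneg (by positivity)]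
  calc ∫ u in (0:ℝ)..1, ‖S u‖ ^ 2
      ≤ ∫ u in (0:ℝ)..1, Real.exp 1 * (Real.exp (-|u|) * ‖S u‖ ^ 2) := by
        refine intervalIntegral.integral_mono_on zero_le_one
          (Continuous.intervalIntegrable (by fun_prop) _ _)
          (Continuous.intervalIntegrable (by fun_prop) _ _) fun u hu => ?_
        rw [← mul_assoc, ← Real.exp_add]
        refine le_mul_of_one_le_left (by positivity) (Real.one_le_exp ?_)
        rw [abs_of_nonneg hu.1]
        linarith [hu.2]
    _ = Real.exp 1 * ∫ u in Set.Ioc (0:ℝ) 1, Real.exp (-|u|) * ‖S u‖ ^ 2 := by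
        rw [intervalIntegral.integral_const_mul, intervalIntegral.integral_of_le zero_le_one]
    _ ≤ Real.exp 1 * ∫ u : ℝ, Real.exp (-|u|) * ‖S u‖ ^ 2 := by
        refine mul_le_mul_of_nonneg_left ?_ (Real.exp_pos _).le
        exact setIntegral_le_integral hI (Filter.Eventually.of_forall fun u => by positivity)
    _ ≤ _ := by gcongr

/-- The substitution `x = exp (n + u)` in the mean square. -/
theorem integral_log_le_integral_exp (F : Finset ℝ) (n : ℝ) :
    (∫ x in Real.exp n..Real.exp (n + 1),
      ‖∑ γ ∈ F, cexp ((1 / 2 + I * (γ : ℂ)) * (Real.log x : ℂ)) / (1 / 2 + I * (γ : ℂ))‖ ^ 2) ≤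
    Real.exp (2 * n + 2) * ∫ u in (0:ℝ)..1,
      ‖∑ γ ∈ F, cexp (I * γ * n) / (1 / 2 + I * (γ : ℂ)) * cexp (I * γ * u)‖ ^ 2 := by
  have hd : ∀ u ∈ Set.uIcc (0:ℝ) 1, HasDerivAt (fun u => Real.exp (n + u)) (Real.exp (n + u)) u := by
    intro u _
    simpa using ((hasDerivAt_id u).const_add n).exp
  have key := intervalIntegral.integral_comp_mul_deriv' (a := 0) (b := 1)
    (f := fun u => Real.exp (n + u))
    (f' := fun u => Real.exp (n + u)) (g := fun x =>
      ‖∑ γ ∈ F, cexp ((1 / 2 + I * (γ : ℂ)) * (Real.log x : ℂ)) / (1 / 2 + I * (γ : ℂ))‖ ^ 2)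
    hd (by fun_prop) (by
      have : ContinuousOn (fun x : ℝ => Real.log x)
          ((fun u => Real.exp (n + u)) '' Set.uIcc (0:ℝ) 1) := by
        refine Real.continuousOn_log.mono ?_
        rintro _ ⟨u, -, rfl⟩
        exact (Real.exp_pos _).ne'
      have h2 : Continuous fun y : ℝ =>
          ‖∑ γ ∈ F, cexp ((1 / 2 + I * (γ : ℂ)) * (y : ℂ)) / (1 / 2 + I * (γ : ℂ))‖ ^ 2 := by
        fun_prop
      exact h2.comp_continuousOn this)
  simp only [add_zero] at key
  rw [← key, ← intervalIntegral.integral_const_mul]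
  refine intervalIntegral.integral_mono_on zero_le_one
    (Continuous.intervalIntegrable ?_ _ _)
    (Continuous.intervalIntegrable (by fun_prop) _ _) fun u hu => ?_
  · simp only [Function.comp_def, Real.log_exp]
    fun_prop
  · have hs : ∑ γ ∈ F, cexp ((1 / 2 + I * (γ : ℂ)) * ((n + u : ℝ) : ℂ)) / (1 / 2 + I * (γ : ℂ)) =
      (Real.exp ((n + u) / 2) : ℂ) *
        ∑ γ ∈ F, cexp (I * γ * n) / (1 / 2 + I * (γ : ℂ)) * cexp (I * γ * u) := by
      rw [Finset.mul_sum]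
      refine Finset.sum_congr rfl fun γ _ => ?_
      rw [show (1 / 2 + I * (γ : ℂ)) * ((n + u : ℝ) : ℂ) =
        (((n + u) / 2 : ℝ) : ℂ) + I * γ * n + I * γ * u by push_cast; ring,
        Complex.exp_add, Complex.exp_add, ofReal_exp]
      ring
    simp only [Function.comp_def, Real.log_exp]
    rw [hs, norm_mul, norm_real, Real.norm_of_nonneg (Real.exp_pos _).le, mul_pow, mul_right_comm,
      ← Real.exp_nat_mul, ← Real.exp_add]
    refine mul_le_mul_of_nonneg_right (Real.exp_le_exp.2 ?_) (by positivity)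
    push_cast
    linarith [hu.2]

/-- Mean-square bound: there is an absolute `K > 0` with
`∫_{eⁿ}^{eⁿ⁺¹} |∑_{γ ∈ F} x^{1/2+iγ}/(1/2+iγ)|² dx ≤ K C² e^{2n} (T + 2)`
under the Weyl-law density hypothesis. -/
theorem mean_square_bound :
    ∃ K : ℝ, 0 < K ∧
      ∀ (F : Finset ℝ) (T C : ℝ), 1 ≤ T → (∀ γ ∈ F, |γ| ≤ T) → 0 < C →
        (∀ t : ℝ,
          (∑ γ ∈ F, if t < ‖(1 / 2 + Complex.I * (γ : ℂ))‖ ∧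
              ‖(1 / 2 + Complex.I * (γ : ℂ))‖ ≤ t + 1 then
              ‖(1 / 2 + Complex.I * (γ : ℂ))‖⁻¹ else 0) ≤ C) →
        ∀ n : ℕ,
          (∫ x in Real.exp n..Real.exp (n + 1),
              ‖∑ γ ∈ F, Complex.exp ((1 / 2 + Complex.I * (γ : ℂ)) * (Real.log x : ℂ)) /
                (1 / 2 + Complex.I * (γ : ℂ))‖ ^ 2)
            ≤ K * C ^ 2 * Real.exp (2 * n) * (T + 2) := by
  set Z : ℝ := ∑' k : ℤ, 1 / (1 + (k : ℝ) ^ 2) with hZ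
  have hZpos : 0 < Z :=
    summable_one_div_one_add_int_sq.tsum_pos (fun k => by positivity) 0 (by norm_num)
  refine ⟨48 * Real.exp 3 * Z, by positivity, fun F T C hT hF hC h n => ?_⟩
  set w : ℝ → ℝ := fun γ => ‖(1 / 2 + I * (γ : ℂ))‖⁻¹ with hw
  have hw0 : ∀ γ, 0 ≤ w γ := fun γ => by positivity
  have hB := sum_unit_block_le hC.le abs_norm_half_add_I_mul_sub_le h hw0
  have hC2 : 0 ≤ 2 * C := by positivity
  have ha : ∀ γ : ℝ, ‖cexp (I * γ * (n : ℝ)) / (1 / 2 + I * (γ : ℂ))‖ = w γ := fun γ => by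
    rw [norm_div, show I * γ * (n : ℝ) = ((γ * n : ℝ) : ℂ) * I by push_cast; ring,
      norm_exp_ofReal_mul_I, one_div]
  have hsum : ∑ γ ∈ F, ∑ δ ∈ F, w γ * w δ * (2 / (1 + (γ - δ) ^ 2)) ≤ 48 * Z * C ^ 2 * (T + 2) := by
    calc _ = ∑ γ ∈ F, w γ * (2 * ∑ δ ∈ F, w δ / (1 + (γ - δ) ^ 2)) := by
          simp only [Finset.mul_sum]
          exact Finset.sum_congr rfl fun γ _ => Finset.sum_congr rfl fun δ _ => by ring
      _ ≤ ∑ γ ∈ F, w γ * (2 * (3 * (2 * C) * Z)) :=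
          Finset.sum_le_sum fun γ _ => mul_le_mul_of_nonneg_left
            (mul_le_mul_of_nonneg_left (sum_div_one_add_sq_le hB hw0 hC2 γ) zero_le_two) (hw0 γ)
      _ = (∑ γ ∈ F, w γ) * (2 * (3 * (2 * C) * Z)) := by rw [Finset.sum_mul]
      _ ≤ (2 * C * (2 * T + 2)) * (2 * (3 * (2 * C) * Z)) :=
          mul_le_mul_of_nonneg_right (sum_le_of_unit_block_le hB hC2 (by linarith) hF) (by positivity)
      _ = 48 * Z * C ^ 2 * (T + 1) := by ring
      _ ≤ _ := by gcongr; norm_num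
  refine (integral_log_le_integral_exp F n).trans ?_
  calc _ ≤ Real.exp (2 * n + 2) *
          (Real.exp 1 * ∑ γ ∈ F, ∑ δ ∈ F, w γ * w δ * (2 / (1 + (γ - δ) ^ 2))) := by
        refine mul_le_mul_of_nonneg_left ?_ (Real.exp_pos _).le
        simpa only [ha] using integral_norm_sq_exp_sum_le F fun γ =>
          cexp (I * γ * (n : ℝ)) / (1 / 2 + I * (γ : ℂ))
    _ ≤ Real.exp (2 * n + 2) * (Real.exp 1 * (48 * Z * C ^ 2 * (T + 2))) := by gcongr
    _ = _ := by
        rw [show (3:ℝ) = 2 + 1 by norm_num, Real.exp_add, Real.exp_add]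
        ring
end

section
/- Let n ≥ 3 be a natural number, let T > 0, M > 0, ε > 0, and let f : [e^n, e^{n+1}) → ℂ be measurable with ∫_{e^n}^{e^{n+1}} |f(x)|² dx ≤ M e^{2n} T. Define A_n = { x ∈ [e^n, e^{n+1}) : |f(x)| > x^{1/2} T^{1/2} (log x)^{1/2} (log log x)^{1/2 + (3/2)ε} }. Then the logarithmic measure of A_n satisfies ∫_{A_n} dx/x ≤ M / ( n (log n)^{1 + 3ε} ). -/
open MeasureTheory Real

/-- The square of the threshold dominates `x T n (log n)^{1+3ε}` on `[eⁿ, ∞)`. -/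
theorem le_threshold_sq {n : ℕ} (hn : 3 ≤ n) {T ε x : ℝ} (hT : 0 < T) (hε : 0 < ε)
    (hx : Real.exp n ≤ x) :
    x * T * (n * (Real.log n) ^ (1 + 3 * ε)) ≤
      (x ^ (1 / 2 : ℝ) * T ^ (1 / 2 : ℝ) * (Real.log x) ^ (1 / 2 : ℝ) *
        (Real.log (Real.log x)) ^ (1 / 2 + 3 / 2 * ε)) ^ 2 := by
  have hn1 : (1 : ℝ) < n := by exact_mod_cast (by omega : 1 < n)
  have hn0 : (0 : ℝ) < n := by linarith
  have hx0 : 0 < x := (Real.exp_pos _).trans_le hx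
  have hlog : (n : ℝ) ≤ Real.log x := (Real.le_log_iff_exp_le hx0).2 hx
  have hlog0 : 0 < Real.log x := hn0.trans_le hlog
  have hloglog : Real.log n ≤ Real.log (Real.log x) := Real.log_le_log hn0 hlog
  have hlogn : 0 < Real.log n := Real.log_pos hn1
  have rpow_half_sq {a : ℝ} (ha : 0 ≤ a) : (a ^ (1 / 2 : ℝ)) ^ 2 = a := by
    rw [← Real.sqrt_eq_rpow, Real.sq_sqrt ha]
  have hpow : ((Real.log (Real.log x)) ^ (1 / 2 + 3 / 2 * ε)) ^ 2 =
      (Real.log (Real.log x)) ^ (1 + 3 * ε) := by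
    rw [← Real.rpow_mul_natCast (hlogn.le.trans hloglog)]
    congr 1
    push_cast
    ring
  rw [mul_pow, mul_pow, mul_pow, rpow_half_sq hx0.le, rpow_half_sq hT.le,
    rpow_half_sq hlog0.le, hpow, mul_assoc (x * T)]
  gcongr

/-- Chebyshev–Markov estimate: if `∫_{eⁿ}^{eⁿ⁺¹} |f|² ≤ M e^{2n} T`, then the set
`Aₙ` where `|f x| > x^{1/2} T^{1/2} (log x)^{1/2} (log log x)^{1/2+3ε/2}` has
logarithmic measure at most `M / (n (log n)^{1+3ε})`. -/
theorem chebyshev_exceptional_set (n : ℕ) (hn : 3 ≤ n) (T M ε : ℝ)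
    (hT : 0 < T) (hM : 0 < M) (hε : 0 < ε) (f : ℝ → ℂ) (hf : Measurable f)
    (hL2 : ∫⁻ x in Set.Ico (Real.exp n) (Real.exp (n + 1)), ENNReal.ofReal (‖f x‖ ^ 2)
        ≤ ENNReal.ofReal (M * Real.exp (2 * n) * T)) :
    ∫⁻ x in {x ∈ Set.Ico (Real.exp n) (Real.exp (n + 1)) |
        x ^ (1 / 2 : ℝ) * T ^ (1 / 2 : ℝ) * (Real.log x) ^ (1 / 2 : ℝ) *
          (Real.log (Real.log x)) ^ (1 / 2 + 3 / 2 * ε) < ‖f x‖},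
        ENNReal.ofReal (1 / x)
      ≤ ENNReal.ofReal (M / (n * (Real.log n) ^ (1 + 3 * ε))) := by
  have hn1 : (1 : ℝ) < n := by exact_mod_cast (by omega : 1 < n)
  have hn0 : (0 : ℝ) < n := by linarith
  have hlogn : 0 < Real.log n := Real.log_pos hn1
  set K : ℝ := n * (Real.log n) ^ (1 + 3 * ε) with hK
  have hK0 : 0 < K := mul_pos hn0 (Real.rpow_pos_of_pos hlogn _)
  set c : ℝ := 1 / (Real.exp (2 * n) * T * K) with hc
  have hc0 : 0 ≤ c := by positivity
  have hmeas : Measurable fun x => ENNReal.ofReal (‖f x‖ ^ 2) := by fun_prop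
  calc
    _ ≤ ∫⁻ x in {x ∈ Set.Ico (Real.exp n) (Real.exp (n + 1)) |
          x ^ (1 / 2 : ℝ) * T ^ (1 / 2 : ℝ) * (Real.log x) ^ (1 / 2 : ℝ) *
            (Real.log (Real.log x)) ^ (1 / 2 + 3 / 2 * ε) < ‖f x‖},
          ENNReal.ofReal c * ENNReal.ofReal (‖f x‖ ^ 2) := by
      refine setLIntegral_mono (hmeas.const_mul _) ?_
      rintro x ⟨⟨hx, -⟩, hfx⟩
      have hx0 : 0 < x := (Real.exp_pos _).trans_le hx
      have hlog0 : 0 < Real.log x := hn0.trans_le ((Real.le_log_iff_exp_le hx0).2 hx)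
      have hloglog0 : 0 ≤ Real.log (Real.log x) :=
        Real.log_nonneg (hn1.le.trans ((Real.le_log_iff_exp_le hx0).2 hx))
      have hsq : x * T * K ≤ ‖f x‖ ^ 2 :=
        (le_threshold_sq hn hT hε hx).trans (pow_le_pow_left₀ (by positivity) hfx.le 2)
      have hexp : Real.exp (2 * n) ≤ x ^ 2 := by
        rw [two_mul, Real.exp_add, ← sq]
        gcongr
      rw [← ENNReal.ofReal_mul hc0]
      refine ENNReal.ofReal_le_ofReal ?_
      rw [hc, one_div_mul_eq_div, div_le_div_iff₀ hx0 (by positivity), one_mul]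
      calc Real.exp (2 * n) * T * K ≤ x ^ 2 * T * K := by gcongr
        _ = x * T * K * x := by ring
        _ ≤ ‖f x‖ ^ 2 * x := by gcongr
    _ ≤ ∫⁻ x in Set.Ico (Real.exp n) (Real.exp (n + 1)),
          ENNReal.ofReal c * ENNReal.ofReal (‖f x‖ ^ 2) :=
      lintegral_mono_set (Set.sep_subset _ _)
    _ ≤ ENNReal.ofReal c * ENNReal.ofReal (M * Real.exp (2 * n) * T) := by
      rw [lintegral_const_mul _ hmeas]
      gcongr
    _ = ENNReal.ofReal (M / K) := by
      rw [← ENNReal.ofReal_mul hc0, hc]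
      congr 1
      field_simp
end

section
/- There exists an absolute constant K > 0 with the following property. Let ε > 0, let n ≥ 3 be a natural number, let F be a finite set of real numbers with ρ(γ) = 1/2 + iγ, let T ≥ 1 with |γ| ≤ T for all γ ∈ F, and suppose there is C > 0 such that for every t ∈ ℝ, ∑_{γ ∈ F, t < |ρ(γ)| ≤ t+1} 1/|ρ(γ)| ≤ C. Then there is a measurable set A_n ⊆ [e^n, e^{n+1}) with logarithmic measure ∫_{A_n} dx/x ≤ K C² (T+2) T^{-1} / ( n (log n)^{1 + 3ε} ) such that for every x ∈ [e^n, e^{n+1}) \ A_n, | ∑_{γ ∈ F} x^{1/2 + iγ} / (1/2 + iγ) | ≤ x^{1/2} T^{1/2} (log x)^{1/2} (log log x)^{1/2 + (3/2)ε}. -/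
open MeasureTheory Real Complex
open scoped Classical

theorem summable_exp_neg_abs_int : Summable fun z : ℤ => Real.exp (-|(z : ℝ)|) := by
  have h : Summable fun n : ℕ => Real.exp (-(n : ℝ)) := Real.summable_exp_neg_nat
  apply Summable.of_nat_of_neg <;> simpa using h

/-- A nonnegative weight with at most mass `C` in each interval `(t, t + 1]` has bounded mass
against an exponentially decaying kernel. -/
theorem sum_mul_exp_neg_abs_sub_le {ι : Type*} (F : Finset ι) (r w : ι → ℝ) {C : ℝ}
    (h : ∀ t : ℝ, (∑ i ∈ F, if t < r i ∧ r i ≤ t + 1 then w i else 0) ≤ C)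
    (hw : ∀ i ∈ F, 0 ≤ w i) (hC : 0 ≤ C) (s : ℝ) :
    ∑ i ∈ F, w i * Real.exp (-|r i - s|) ≤
      C * Real.exp 1 * ∑' z : ℤ, Real.exp (-|(z : ℝ)|) := by
  set g : ι → ℤ := fun i => ⌈r i - s⌉ with hg
  rw [← Finset.sum_fiberwise_of_maps_to (t := F.image g) (g := g)
    (fun i hi => Finset.mem_image_of_mem g hi)]
  calc _ ≤ ∑ z ∈ F.image g, C * Real.exp 1 * Real.exp (-|(z : ℝ)|) := by
        refine Finset.sum_le_sum fun z _ => ?_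
        calc _ ≤ ∑ i ∈ F with g i = z, w i * (Real.exp 1 * Real.exp (-|(z : ℝ)|)) := by
              refine Finset.sum_le_sum fun i hi => ?_
              rw [Finset.mem_filter] at hi
              refine mul_le_mul_of_nonneg_left ?_ (hw i hi.1)
              rw [← Real.exp_add, Real.exp_le_exp]
              have h1 := Int.ceil_lt_add_one (r i - s)
              have h2 := Int.le_ceil (r i - s)
              have h3 : ((⌈r i - s⌉ : ℤ) : ℝ) = z := by exact_mod_cast hi.2
              rw [h3] at h1 h2
              have h4 := abs_sub_abs_le_abs_sub (z : ℝ) (r i - s)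
              have h5 : |z - (r i - s)| ≤ 1 := abs_le.2 ⟨by linarith, by linarith⟩
              linarith
          _ = (∑ i ∈ F with g i = z, w i) * (Real.exp 1 * Real.exp (-|(z : ℝ)|)) := by
              rw [Finset.sum_mul]
          _ ≤ C * (Real.exp 1 * Real.exp (-|(z : ℝ)|)) := by
              refine mul_le_mul_of_nonneg_right ?_ (by positivity)
              refine le_trans (le_of_eq ?_) (h (s + z - 1))
              rw [Finset.sum_filter]
              refine Finset.sum_congr rfl fun i _ => ?_
              refine if_congr ?_ rfl rfl
              rw [hg, Int.ceil_eq_iff]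
              constructor <;> rintro ⟨h1, h2⟩ <;> constructor <;> linarith
          _ = _ := by ring
    _ = C * Real.exp 1 * ∑ z ∈ F.image g, Real.exp (-|(z : ℝ)|) := by rw [Finset.mul_sum]
    _ ≤ _ := by
        refine mul_le_mul_of_nonneg_left ?_ (by positivity)
        exact summable_exp_neg_abs_int.sum_le_tsum _ fun _ _ => by positivity

theorem sum_le_mul_of_unit_interval_bound {ι : Type*} (F : Finset ι) (r w : ι → ℝ) {C R : ℝ}
    (h : ∀ t : ℝ, (∑ i ∈ F, if t < r i ∧ r i ≤ t + 1 then w i else 0) ≤ C)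
    (hC : 0 ≤ C) (hr : ∀ i ∈ F, 0 < r i) (hR : ∀ i ∈ F, r i ≤ R) (hR0 : 0 ≤ R) :
    ∑ i ∈ F, w i ≤ C * (R + 1) := by
  have hmaps : ∀ i ∈ F, ⌈r i⌉₊ - 1 ∈ Finset.range ⌈R⌉₊ := by
    intro i hi
    have h1 := Nat.ceil_pos.2 (hr i hi)
    have h2 := Nat.ceil_mono (hR i hi)
    rw [Finset.mem_range]
    omega
  rw [← Finset.sum_fiberwise_of_maps_to hmaps]
  calc _ ≤ ∑ m ∈ Finset.range ⌈R⌉₊, C := by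
        refine Finset.sum_le_sum fun m _ => ?_
        refine le_trans (le_of_eq ?_) (h m)
        rw [Finset.sum_filter]
        refine Finset.sum_congr rfl fun i hi => if_congr ?_ rfl rfl
        have h1 := Nat.ceil_pos.2 (hr i hi)
        have h2 : ⌈r i⌉₊ - 1 = m ↔ ⌈r i⌉₊ = m + 1 := by omega
        rw [h2, Nat.ceil_eq_iff (by omega)]
        simp
    _ = C * ⌈R⌉₊ := by simp [mul_comm]
    _ ≤ _ := mul_le_mul_of_nonneg_left (Nat.ceil_lt_add_one hR0).le hC

theorem integrable_cexp_I_mul_gaussian (t : ℝ) :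
    Integrable fun v : ℝ => Complex.exp (Complex.I * t * v) * Complex.exp (-1 * (v : ℂ) ^ 2) := by
  have h : Integrable fun v : ℝ => Complex.exp (-1 * (v : ℂ) ^ 2) := by
    simpa using integrable_cexp_neg_mul_sq (b := 1) (by simp)
  refine h.bdd_mul (c := 1) (by fun_prop) (.of_forall fun v => ?_)
  rw [Complex.norm_exp]
  simp

theorem norm_integral_cexp_I_mul_gaussian (t : ℝ) :
    ‖∫ v : ℝ, Complex.exp (Complex.I * t * v) * Complex.exp (-1 * (v : ℂ) ^ 2)‖ =
      √π * Real.exp (-t ^ 2 / 4) := by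
  rw [fourierIntegral_gaussian (by simp), norm_mul]
  congr 1
  · rw [div_one, Complex.norm_cpow_eq_rpow_re_of_pos Real.pi_pos, Real.sqrt_eq_rpow]
    norm_num
  · rw [Complex.norm_exp]
    congr 1
    rw [show (-(t : ℂ) ^ 2 / (4 * 1)) = ((-t ^ 2 / 4 : ℝ) : ℂ) by push_cast; ring,
      Complex.ofReal_re]

theorem ofReal_norm_sq_mul_gaussian (F : Finset ℝ) (a : ℝ → ℂ) (v : ℝ) :
    ((‖∑ γ ∈ F, a γ * Complex.exp (Complex.I * γ * v)‖ ^ 2 * Real.exp (-v ^ 2) : ℝ) : ℂ) =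
      ∑ γ ∈ F, ∑ δ ∈ F, a γ * (starRingEnd ℂ) (a δ) *
        (Complex.exp (Complex.I * (γ - δ : ℝ) * v) * Complex.exp (-1 * (v : ℂ) ^ 2)) := by
  push_cast
  rw [← Complex.mul_conj', map_sum, Finset.sum_mul_sum, Finset.sum_mul]
  refine Finset.sum_congr rfl fun γ _ => ?_
  rw [Finset.sum_mul]
  refine Finset.sum_congr rfl fun δ _ => ?_
  rw [map_mul, ← Complex.exp_conj]
  simp only [map_mul, Complex.conj_I, Complex.conj_ofReal]
  rw [show Complex.I * ((γ : ℂ) - δ) * v = Complex.I * γ * v + -Complex.I * δ * v by ring,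
    Complex.exp_add, neg_one_mul]
  ring

theorem integrable_norm_sq_mul_gaussian (F : Finset ℝ) (a : ℝ → ℂ) :
    Integrable fun v : ℝ =>
      ‖∑ γ ∈ F, a γ * Complex.exp (Complex.I * γ * v)‖ ^ 2 * Real.exp (-v ^ 2) := by
  have h : Integrable fun v : ℝ =>
      ((‖∑ γ ∈ F, a γ * Complex.exp (Complex.I * γ * v)‖ ^ 2 * Real.exp (-v ^ 2) : ℝ) : ℂ) := by
    simp only [ofReal_norm_sq_mul_gaussian]
    exact integrable_finsetSum _ fun γ _ => integrable_finsetSum _ fun δ _ =>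
      (integrable_cexp_I_mul_gaussian (γ - δ)).const_mul _
  exact_mod_cast h.re

/-- Large-sieve type bound for the Gaussian mean square of an exponential sum. -/
theorem integral_norm_sq_mul_gaussian_le (F : Finset ℝ) (a : ℝ → ℂ) :
    ∫ v : ℝ, ‖∑ γ ∈ F, a γ * Complex.exp (Complex.I * γ * v)‖ ^ 2 * Real.exp (-v ^ 2) ≤
      √π * ∑ γ ∈ F, ∑ δ ∈ F, ‖a γ‖ * ‖a δ‖ * Real.exp (-(γ - δ) ^ 2 / 4) := by
  refine (Real.le_norm_self _).trans ?_
  rw [← Complex.norm_real, ← integral_complex_ofReal]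
  simp only [ofReal_norm_sq_mul_gaussian]
  have hint : ∀ γ δ : ℝ, Integrable fun v : ℝ => a γ * (starRingEnd ℂ) (a δ) *
      (Complex.exp (Complex.I * (γ - δ : ℝ) * v) * Complex.exp (-1 * (v : ℂ) ^ 2)) :=
    fun γ δ => (integrable_cexp_I_mul_gaussian (γ - δ)).const_mul _
  rw [integral_finsetSum _ fun γ _ => integrable_finsetSum _ fun δ _ => hint γ δ, Finset.mul_sum]
  refine norm_sum_le_of_le _ fun γ _ => ?_
  rw [integral_finsetSum _ fun δ _ => hint γ δ, Finset.mul_sum]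
  refine norm_sum_le_of_le _ fun δ _ => le_of_eq ?_
  rw [integral_const_mul, norm_mul, norm_integral_cexp_I_mul_gaussian, norm_mul, RCLike.norm_conj]
  ring

/-- Mean-square bound for an exponential sum whose coefficients obey a density hypothesis. -/
theorem integral_norm_sq_mul_gaussian_le_of_density (F : Finset ℝ) (a : ℝ → ℂ) (r : ℝ → ℝ)
    {C R : ℝ}
    (h : ∀ t : ℝ, (∑ γ ∈ F, if t < r γ ∧ r γ ≤ t + 1 then ‖a γ‖ else 0) ≤ C)
    (hC : 0 ≤ C) (hr : ∀ γ ∈ F, 0 < r γ) (hR : ∀ γ ∈ F, r γ ≤ R) (hR0 : 0 ≤ R)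
    (hlip : ∀ γ δ, |r γ - r δ| ≤ |γ - δ|) :
    ∫ v : ℝ, ‖∑ γ ∈ F, a γ * Complex.exp (Complex.I * γ * v)‖ ^ 2 * Real.exp (-v ^ 2) ≤
      √π * Real.exp 2 * (∑' z : ℤ, Real.exp (-|(z : ℝ)|)) * C ^ 2 * (R + 1) := by
  set B := ∑' z : ℤ, Real.exp (-|(z : ℝ)|) with hB
  have hB0 : 0 ≤ B := tsum_nonneg fun _ => by positivity
  have hker : ∀ γ δ, Real.exp (-(γ - δ) ^ 2 / 4) ≤ Real.exp 1 * Real.exp (-|r δ - r γ|) := by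
    intro γ δ
    rw [← Real.exp_add, Real.exp_le_exp]
    have h1 := hlip γ δ
    rw [abs_sub_comm (r γ)] at h1
    nlinarith [sq_nonneg (|γ - δ| / 2 - 1), sq_abs (γ - δ)]
  calc _ ≤ _ := integral_norm_sq_mul_gaussian_le F a
    _ ≤ √π * ∑ γ ∈ F, ‖a γ‖ * (Real.exp 1 * (C * Real.exp 1 * B)) := by
        refine mul_le_mul_of_nonneg_left ?_ (Real.sqrt_nonneg _)
        refine Finset.sum_le_sum fun γ _ => ?_
        simp only [mul_assoc ‖a γ‖]
        rw [← Finset.mul_sum]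
        refine mul_le_mul_of_nonneg_left ?_ (norm_nonneg _)
        calc _ ≤ ∑ δ ∈ F, Real.exp 1 * (‖a δ‖ * Real.exp (-|r δ - r γ|)) := by
              refine Finset.sum_le_sum fun δ _ => ?_
              rw [mul_left_comm]
              exact mul_le_mul_of_nonneg_left (hker γ δ) (norm_nonneg _)
          _ ≤ _ := by
              rw [← Finset.mul_sum]
              exact mul_le_mul_of_nonneg_left
                (sum_mul_exp_neg_abs_sub_le F r _ h (fun _ _ => norm_nonneg _) hC _)
                (by positivity)
    _ = √π * ((∑ γ ∈ F, ‖a γ‖) * (Real.exp 1 * (C * Real.exp 1 * B))) := by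
        rw [Finset.sum_mul]
    _ ≤ √π * ((C * (R + 1)) * (Real.exp 1 * (C * Real.exp 1 * B))) := by
        gcongr
        exact sum_le_mul_of_unit_interval_bound F r _ h hC hr hR hR0
    _ = _ := by
        rw [show (2 : ℝ) = 1 + 1 by norm_num, Real.exp_add]
        ring

/-- Chebyshev's inequality on `[0, 1)` with a Gaussian majorant. -/
theorem volume_large_values_le (f : ℝ → ℝ) (hf0 : ∀ v, 0 ≤ f v)
    (hf : Integrable fun v => f v * Real.exp (-v ^ 2)) {V : ℝ} (hV : 0 < V) :
    volume {v | v ∈ Set.Ico (0 : ℝ) 1 ∧ V ≤ f v} ≤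
      ENNReal.ofReal (Real.exp 1 * (∫ v, f v * Real.exp (-v ^ 2)) / V) := by
  have hsub : {v | v ∈ Set.Ico (0 : ℝ) 1 ∧ V ≤ f v} ⊆
      {v | V ≤ Real.exp 1 * (f v * Real.exp (-v ^ 2))} := by
    rintro v ⟨⟨h0, h1⟩, hv⟩
    refine hv.trans ?_
    rw [mul_left_comm, ← Real.exp_add]
    exact le_mul_of_one_le_right (hf0 v) (Real.one_le_exp (by nlinarith))
  have hint := hf.const_mul (Real.exp 1)
  have hfin := hint.measure_ge_lt_top hV
  have h := mul_meas_ge_le_integral_of_nonneg (.of_forall fun v => by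
    have := hf0 v
    show 0 ≤ _
    positivity) hint V
  rw [integral_const_mul] at h
  refine (measure_mono hsub).trans ?_
  rw [← ENNReal.ofReal_toReal hfin.ne]
  refine ENNReal.ofReal_le_ofReal ?_
  rw [le_div_iff₀ hV, mul_comm]
  exact h

theorem setLIntegral_one_div_image_exp_add (c : ℝ) {B : Set ℝ} (hB : MeasurableSet B) :
    ∫⁻ x in (fun v => Real.exp (c + v)) '' B, ENNReal.ofReal (1 / x) = volume B := by
  rw [lintegral_image_eq_lintegral_abs_deriv_mul (f' := fun v => Real.exp (c + v)) hB
    (fun v _ => ?_) ?_]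
  · rw [← setLIntegral_one]
    refine lintegral_congr fun v => ?_
    rw [← ENNReal.ofReal_mul (abs_nonneg _), abs_of_pos (Real.exp_pos _),
      mul_one_div_cancel (Real.exp_pos _).ne', ENNReal.ofReal_one]
  · intro u _ v _ huv
    simpa using huv
  · simpa using (((hasDerivAt_id v).const_add c).exp).hasDerivWithinAt

/-- There is an absolute `K > 0` such that, under the Weyl-law density hypothesis,
the zero sum `∑_{γ ∈ F} x^{1/2+iγ}/(1/2+iγ)` is bounded by
`x^{1/2} T^{1/2} (log x)^{1/2} (log log x)^{1/2+3ε/2}` for all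
`x ∈ [eⁿ, eⁿ⁺¹)` outside an exceptional set `Aₙ` of logarithmic measure at most
`K C² (T+2) T⁻¹ / (n (log n)^{1+3ε})`. -/
theorem zero_sum_outside_exceptional_set :
    ∃ K : ℝ, 0 < K ∧
      ∀ (ε : ℝ), 0 < ε → ∀ (n : ℕ), 3 ≤ n →
        ∀ (F : Finset ℝ) (T C : ℝ), 1 ≤ T → (∀ γ ∈ F, |γ| ≤ T) → 0 < C →
          (∀ t : ℝ,
            (∑ γ ∈ F, if t < ‖(1 / 2 + Complex.I * (γ : ℂ))‖ ∧
                ‖(1 / 2 + Complex.I * (γ : ℂ))‖ ≤ t + 1 then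
                ‖(1 / 2 + Complex.I * (γ : ℂ))‖⁻¹ else 0) ≤ C) →
          ∃ A : Set ℝ, MeasurableSet A ∧ A ⊆ Set.Ico (Real.exp n) (Real.exp (n + 1)) ∧
            (∫⁻ x in A, ENNReal.ofReal (1 / x)
              ≤ ENNReal.ofReal (K * C ^ 2 * (T + 2) * T⁻¹ /
                  (n * (Real.log n) ^ (1 + 3 * ε)))) ∧
            ∀ x ∈ Set.Ico (Real.exp n) (Real.exp (n + 1)) \ A,
              ‖∑ γ ∈ F, Complex.exp ((1 / 2 + Complex.I * (γ : ℂ)) * (Real.log x : ℂ)) /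
                  (1 / 2 + Complex.I * (γ : ℂ))‖
                ≤ x ^ (1 / 2 : ℝ) * T ^ (1 / 2 : ℝ) * (Real.log x) ^ (1 / 2 : ℝ) *
                    (Real.log (Real.log x)) ^ (1 / 2 + 3 / 2 * ε) := by
  set B := ∑' z : ℤ, Real.exp (-|(z : ℝ)|) with hB
  have hB0 : 0 < B := summable_exp_neg_abs_int.tsum_pos (fun _ => by positivity) 0 (by positivity)
  refine ⟨Real.exp 1 * (√π * Real.exp 2 * B), by positivity, ?_⟩
  intro ε hε n hn F T C hT hF hC h
  have hn3 : (3 : ℝ) ≤ n := by exact_mod_cast hn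
  have hlogn : 0 < Real.log n := Real.log_pos (by linarith)
  set r : ℝ → ℝ := fun γ => ‖(1 / 2 + Complex.I * (γ : ℂ))‖ with hr
  have hrho : ∀ γ : ℝ, (1 / 2 + Complex.I * (γ : ℂ)) ≠ 0 := fun γ h0 => by
    have := congrArg Complex.re h0
    norm_num at this
  set a : ℝ → ℂ := fun γ =>
    Complex.exp (Complex.I * γ * n) / (1 / 2 + Complex.I * (γ : ℂ)) with ha
  have hna : ∀ γ, ‖a γ‖ = (r γ)⁻¹ := fun γ => by
    rw [ha, norm_div, Complex.norm_exp]
    simp [hr]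
  set S : ℝ → ℂ := fun v => ∑ γ ∈ F, a γ * Complex.exp (Complex.I * γ * v) with hS
  have hScont : Continuous S := by fun_prop
  have hmean : ∫ v : ℝ, ‖S v‖ ^ 2 * Real.exp (-v ^ 2) ≤
      √π * Real.exp 2 * B * C ^ 2 * ((T + 1) + 1) := by
    refine integral_norm_sq_mul_gaussian_le_of_density F a r ?_ hC.le
      (fun γ _ => norm_pos_iff.2 (hrho γ)) (fun γ hγ => ?_) (by linarith) (fun γ δ => ?_)
    · simpa only [hna] using h
    · refine (norm_add_le _ _).trans ?_
      have := hF γ hγ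
      norm_num
      linarith
    · refine (abs_norm_sub_norm_le _ _).trans (le_of_eq ?_)
      rw [add_sub_add_left_eq_sub, ← mul_sub, norm_mul, Complex.norm_I, one_mul,
        ← Complex.ofReal_sub, Complex.norm_real, Real.norm_eq_abs]
  set V : ℝ := T * n * (Real.log n) ^ (1 + 3 * ε) with hV
  have hV0 : 0 < V := by positivity
  set E : Set ℝ := {v | v ∈ Set.Ico (0 : ℝ) 1 ∧ V ≤ ‖S v‖ ^ 2} with hE
  have hEm : MeasurableSet E :=
    measurableSet_Ico.inter (measurableSet_le measurable_const (hScont.norm.pow 2).measurable)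
  refine ⟨(fun v => Real.exp (n + v)) '' E, ?_, ?_, ?_, ?_⟩
  · refine hEm.image_of_continuousOn_injOn (by fun_prop) ?_
    intro u _ v _ huv
    simpa using huv
  · rintro _ ⟨v, ⟨⟨h0, h1⟩, -⟩, rfl⟩
    exact ⟨Real.exp_le_exp.2 (by linarith), Real.exp_lt_exp.2 (by linarith)⟩
  · rw [setLIntegral_one_div_image_exp_add _ hEm]
    refine (volume_large_values_le (fun v => ‖S v‖ ^ 2) (fun _ => by positivity)
      (integrable_norm_sq_mul_gaussian F a) hV0).trans (ENNReal.ofReal_le_ofReal ?_)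
    calc _ ≤ Real.exp 1 * (√π * Real.exp 2 * B * C ^ 2 * ((T + 1) + 1)) / V := by gcongr
      _ = _ := by
        rw [hV]
        field_simp
        ring
  · rintro x ⟨⟨hx0, hx1⟩, hxA⟩
    have hxpos : 0 < x := (Real.exp_pos _).trans_le hx0
    have hlx0 : (n : ℝ) ≤ Real.log x := (Real.le_log_iff_exp_le hxpos).2 hx0
    have hlx1 : Real.log x < n + 1 := (Real.log_lt_iff_lt_exp hxpos).2 hx1
    have hSx : ‖S (Real.log x - n)‖ ^ 2 < V := by
      by_contra! hge
      refine hxA ⟨Real.log x - n, ⟨⟨by linarith, by linarith⟩, hge⟩, ?_⟩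
      simp [Real.exp_log hxpos]
    have hll : Real.log n ≤ Real.log (Real.log x) := Real.log_le_log (by linarith) hlx0
    have hlx : 0 < Real.log x := by linarith
    have hllx : 0 < Real.log (Real.log x) := by linarith
    have hsum : ∑ γ ∈ F, Complex.exp ((1 / 2 + Complex.I * (γ : ℂ)) * (Real.log x : ℂ)) /
        (1 / 2 + Complex.I * (γ : ℂ)) = ((x ^ (1 / 2 : ℝ) : ℝ) : ℂ) * S (Real.log x - n) := by
      rw [hS, Finset.mul_sum]
      refine Finset.sum_congr rfl fun γ _ => ?_
      rw [ha, Real.rpow_def_of_pos hxpos, Complex.ofReal_exp, div_mul_eq_mul_div, mul_div_assoc',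
        ← Complex.exp_add, ← Complex.exp_add]
      congr 2
      push_cast
      ring
    rw [hsum, norm_mul, Complex.norm_real, Real.norm_of_nonneg (by positivity), mul_assoc,
      mul_assoc]
    refine mul_le_mul_of_nonneg_left ?_ (by positivity)
    refine le_of_sq_le_sq (hSx.le.trans ?_) (by positivity)
    have hsq : ∀ y : ℝ, 0 < y → ∀ p : ℝ, (y ^ p) ^ 2 = y ^ (2 * p) := fun y hy p => by
      rw [← Real.rpow_natCast, ← Real.rpow_mul hy.le, mul_comm]
      norm_num
    rw [mul_pow, mul_pow, hsq T (by linarith), hsq _ hlx, hsq _ hllx,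
      show (2 : ℝ) * (1 / 2 + 3 / 2 * ε) = 1 + 3 * ε by ring, show (2 : ℝ) * (1 / 2) = 1 by ring,
      Real.rpow_one, Real.rpow_one, hV, mul_assoc]
    gcongr
end
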